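/- Let s, t > 0 be real numbers and let G = (V, E) be a finite simple graph with V nonempty such that ‖V‖ > (s + t + 1)·|V|. Then there exists a partition (A, B) of V with both A and B nonempty such that ‖A‖ > s·|A| and ‖B‖ > t·|B|. -/

import Mathlib

open Finset

/-- `G.edgesIn X` is the number of edges of the induced subgraph `G[X]`,
i.e. the number of edges of `G` with both endpoints in `X`. -/
noncomputable def SimpleGraph.edgesIn {V : Type*} (G : SimpleGraph V) (X : Finset V) : ℕ :=
  {e ∈ G.edgeSet | ∀ v ∈ e, v ∈ X}.ncard

namespace SimpleGraph

variable {V : Type*} (G : SimpleGraph V)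

open Classical in
/-- The number of neighbours of `v` in `X`. -/
noncomputable def degreeIn (X : Finset V) (v : V) : ℕ :=
  #{w ∈ X | G.Adj v w}

lemma edgesIn_empty : G.edgesIn ∅ = 0 := by
  have h : {e ∈ G.edgeSet | ∀ v ∈ e, v ∈ (∅ : Finset V)} = ∅ := by
    ext e
    induction e with
    | h a b => simpa using fun _ => ⟨b, fun _ => rfl⟩
  rw [edgesIn, h, Set.ncard_empty]

lemma edgesIn_insert [DecidableEq V] {X : Finset V} {v : V} (hv : v ∉ X) :
    G.edgesIn (insert v X) = G.edgesIn X + G.degreeIn X v := by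
  classical
  have h : {e ∈ G.edgeSet | ∀ w ∈ e, w ∈ insert v X} =
      {e ∈ G.edgeSet | ∀ w ∈ e, w ∈ X} ∪
        (fun w => s(v, w)) '' ({w ∈ X | G.Adj v w} : Finset V) := by
    ext e
    induction e with
    | h a b =>
      simp only [Set.mem_ofPred_eq, mem_edgeSet, Sym2.mem_iff, Finset.mem_insert, Set.mem_union,
        Set.mem_image, Finset.mem_coe, Finset.mem_filter, Sym2.eq_iff, forall_eq_or_imp, forall_eq]
      constructor
      · rintro ⟨hab, rfl | ha, rfl | hb⟩
        · exact absurd hab (G.loopless.irrefl _)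
        · exact Or.inr ⟨b, ⟨hb, hab⟩, Or.inl ⟨rfl, rfl⟩⟩
        · exact Or.inr ⟨a, ⟨ha, hab.symm⟩, Or.inr ⟨rfl, rfl⟩⟩
        · exact Or.inl ⟨hab, ha, hb⟩
      · rintro (⟨hab, ha, hb⟩ | ⟨w, ⟨hw, hvw⟩, ⟨rfl, rfl⟩ | ⟨rfl, rfl⟩⟩)
        · exact ⟨hab, Or.inr ha, Or.inr hb⟩
        · exact ⟨hvw, Or.inl rfl, Or.inr hw⟩
        · exact ⟨hvw.symm, Or.inr hw, Or.inl rfl⟩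
  have hfin : {e ∈ G.edgeSet | ∀ w ∈ e, w ∈ X}.Finite := by
    refine (X.sym2.finite_toSet).subset fun e he => ?_
    exact Finset.mem_coe.2 (Finset.mem_sym2_iff.2 he.2)
  rw [edgesIn, h, Set.ncard_union_eq _ hfin ((Finset.finite_toSet _).image _),
    Set.ncard_image_of_injective _ (fun a b => Sym2.congr_right.1), Set.ncard_coe_finset]
  · rfl
  · rw [Set.disjoint_left]
    rintro _ ⟨-, he⟩ ⟨w, -, rfl⟩
    exact hv (he v (by simp))

lemma edgesIn_erase [DecidableEq V] {X : Finset V} {v : V} (hv : v ∈ X) :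
    G.edgesIn (X.erase v) + G.degreeIn X v = G.edgesIn X := by
  have h : G.degreeIn X v = G.degreeIn (X.erase v) v := by
    unfold degreeIn
    congr 1
    ext w
    simp only [Finset.mem_filter, Finset.mem_erase]
    exact ⟨fun ⟨hw, ha⟩ => ⟨⟨ha.ne', hw⟩, ha⟩, fun ⟨hw, ha⟩ => ⟨hw.2, ha⟩⟩
  rw [h, ← G.edgesIn_insert (Finset.notMem_erase v X), Finset.insert_erase hv]

lemma degreeIn_add_one_le {X : Finset V} {v : V} (hv : v ∈ X) :
    G.degreeIn X v + 1 ≤ #X := by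
  classical
  refine Finset.card_lt_card (Finset.filter_ssubset.2 ⟨v, hv, ?_⟩)
  simp

lemma degreeIn_insert [DecidableEq V] {X : Finset V} {v w : V} (hv : v ∉ X) :
    G.degreeIn (insert v X) w = G.degreeIn X w + G.degreeIn {v} w := by
  classical
  unfold degreeIn
  rw [Finset.insert_eq, Finset.union_comm, Finset.filter_union, Finset.card_union_of_disjoint]
  exact Finset.disjoint_filter_filter (by simpa using hv)

lemma sum_degreeIn_singleton (X : Finset V) (v : V) :
    ∑ w ∈ X, G.degreeIn {v} w = G.degreeIn X v := by
  unfold degreeIn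
  rw [Finset.card_filter]
  refine Finset.sum_congr rfl fun w _ => ?_
  rw [Finset.filter_singleton, G.adj_comm]
  split_ifs <;> rfl

lemma sum_degreeIn (X : Finset V) : ∑ v ∈ X, G.degreeIn X v = 2 * G.edgesIn X := by
  classical
  induction X using Finset.induction_on with
  | empty => simp [edgesIn_empty]
  | insert v X hv ih =>
    have h0 : G.degreeIn {v} v = 0 := by simp [degreeIn]
    simp only [G.degreeIn_insert hv, Finset.sum_insert hv, Finset.sum_add_distrib, ih,
      sum_degreeIn_singleton, G.edgesIn_insert hv, h0]
    ring

lemma edgesIn_union [DecidableEq V] {A B : Finset V} (h : Disjoint A B) :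
    G.edgesIn (A ∪ B) = G.edgesIn A + G.edgesIn B + ∑ v ∈ A, G.degreeIn B v := by
  induction A using Finset.induction_on with
  | empty => simp [edgesIn_empty]
  | insert v A hv ih =>
    rw [Finset.disjoint_insert_left] at h
    have hdeg : G.degreeIn (A ∪ B) v = G.degreeIn A v + G.degreeIn B v := by
      classical
      unfold degreeIn
      rw [Finset.filter_union, Finset.card_union_of_disjoint
        (Finset.disjoint_filter_filter h.2)]
    rw [Finset.insert_union, G.edgesIn_insert (by simp [hv, h.1]), ih h.2, hdeg,
      G.edgesIn_insert hv, Finset.sum_insert hv]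
    ring

lemma two_mul_edgesIn_le (X : Finset V) : 2 * G.edgesIn X ≤ #X * (#X - 1) := by
  rw [← G.sum_degreeIn, ← smul_eq_mul]
  exact Finset.sum_le_card_nsmul _ _ _ fun v hv => Nat.le_sub_one_of_lt (G.degreeIn_add_one_le hv)

/-- Some vertex can be moved from `A` to `B` while keeping the inequality
`‖A‖ / (|A| - 1) + ‖B‖ / |B| ≥ ‖A ∪ B‖ / (|A| + |B|)`, here with denominators cleared:
the uniform average over all vertices of `A` does. -/
lemma exists_move [DecidableEq V] {A B : Finset V} (hdisj : Disjoint A B) {K : ℝ} (hA : 2 ≤ #A)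
    (hK : K * (#A + #B) ≤ G.edgesIn (A ∪ B))
    (hAB : K * (#A - 1) * #B ≤ #B * (G.edgesIn A : ℝ) + (#A - 1) * G.edgesIn B) :
    ∃ v ∈ A, K * (#A - 2) * (#B + 1) ≤
      (#B + 1) * (G.edgesIn (A.erase v) : ℝ) + (#A - 2) * G.edgesIn (insert v B) := by
  have hA' : (2 : ℝ) ≤ #A := by exact_mod_cast hA
  refine Finset.exists_le_of_sum_le (Finset.card_pos.1 (by omega)) ?_
  have h1 : ∀ v ∈ A, (#B + 1) * (G.edgesIn (A.erase v) : ℝ) + (#A - 2) * G.edgesIn (insert v B) =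
      (#B + 1) * (G.edgesIn A - (G.degreeIn A v : ℝ)) +
        (#A - 2) * (G.edgesIn B + (G.degreeIn B v : ℝ)) := by
    intro v hv
    rw [G.edgesIn_insert (Finset.disjoint_left.1 hdisj hv), ← G.edgesIn_erase hv]
    push_cast
    ring
  have h2 : ∑ v ∈ A, (G.degreeIn A v : ℝ) = 2 * G.edgesIn A := by
    exact_mod_cast G.sum_degreeIn A
  have h3 : ∑ v ∈ A, (G.degreeIn B v : ℝ) = G.edgesIn (A ∪ B) - G.edgesIn A - G.edgesIn B := by
    rw [G.edgesIn_union hdisj]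
    push_cast
    ring
  rw [Finset.sum_const, nsmul_eq_mul, Finset.sum_congr rfl h1]
  simp only [Finset.sum_add_distrib, ← Finset.mul_sum, Finset.sum_sub_distrib, h2, h3,
    Finset.sum_const, nsmul_eq_mul]
  have h4 := mul_le_mul_of_nonneg_left (add_le_add hK hAB) (sub_nonneg.2 hA')
  linarith

end SimpleGraph

/-- Every graph with `‖V‖ > (s+t+1)|V|` has a partition into nonempty parts `A`, `B`
with `‖A‖ > s|A|` and `‖B‖ > t|B|`. -/
theorem avg_degree_partition_strict {V : Type*} [Fintype V] [Nonempty V] [DecidableEq V]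
    (G : SimpleGraph V) (s t : ℝ) (hs : 0 < s) (ht : 0 < t)
    (h : (s + t + 1) * (Fintype.card V : ℝ) < (G.edgesIn Finset.univ : ℝ)) :
    ∃ A B : Finset V, A.Nonempty ∧ B.Nonempty ∧ Disjoint A B ∧ A ∪ B = Finset.univ ∧
      s * (A.card : ℝ) < (G.edgesIn A : ℝ) ∧ t * (B.card : ℝ) < (G.edgesIn B : ℝ) := by
  have hn : (0 : ℝ) < Fintype.card V := by exact_mod_cast Fintype.card_pos
  obtain ⟨K, hK, hKe⟩ : ∃ K : ℝ, s + t + 1 < K ∧ K * Fintype.card V = G.edgesIn Finset.univ :=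
    ⟨G.edgesIn Finset.univ / Fintype.card V, (lt_div_iff₀ hn).2 h, div_mul_cancel₀ _ hn.ne'⟩
  have hV : 2 ≤ Fintype.card V := by
    have h1 := G.two_mul_edgesIn_le Finset.univ
    rw [Finset.card_univ] at h1
    by_contra hlt
    rw [show Fintype.card V - 1 = 0 by omega, mul_zero] at h1
    have h2 : (G.edgesIn Finset.univ : ℝ) = 0 := by exact_mod_cast (by omega)
    rw [h2] at h
    nlinarith
  have hcard (A : Finset V) : (#A : ℝ) + #Aᶜ = Fintype.card V := by
    exact_mod_cast Finset.card_add_card_compl A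
  let P (A : Finset V) : Prop := 2 ≤ #A ∧ (G.edgesIn Aᶜ : ℝ) ≤ t * #Aᶜ ∧
    K * (#A - 1) * #Aᶜ ≤ #Aᶜ * (G.edgesIn A : ℝ) + (#A - 1) * G.edgesIn Aᶜ
  obtain ⟨A, ⟨hA2, hAt, hAK⟩, hmin⟩ : ∃ A, P A ∧ ∀ A', P A' → #A ≤ #A' := by
    have hP : ∃ A, P A := ⟨Finset.univ, by simpa [P, G.edgesIn_empty] using hV⟩
    obtain ⟨A, hA, hmin⟩ := exists_minimalFor_of_wellFoundedLT P Finset.card hP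
    exact ⟨A, hA, fun A' hA' => (le_total _ _).elim id fun hle => hmin hA' hle⟩
  have hA2' : (2 : ℝ) ≤ #A := by exact_mod_cast hA2
  have hAe : (K - t) * (#A - 1) ≤ G.edgesIn A := by
    rcases Finset.eq_empty_or_nonempty Aᶜ with hB | hB
    · rw [Finset.compl_eq_empty_iff] at hB
      rw [hB, ← hKe, Finset.card_univ]
      nlinarith
    · have hB' : (0 : ℝ) < #Aᶜ := by exact_mod_cast hB.card_pos
      refine le_of_mul_le_mul_left ?_ hB'
      nlinarith
  have hA3 : 3 ≤ #A := by
    by_contra hlt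
    have hA : #A = 2 := by omega
    have h1 := G.two_mul_edgesIn_le A
    rw [hA] at h1 hAe
    have h2 : (G.edgesIn A : ℝ) ≤ 1 := by exact_mod_cast (by omega)
    push_cast at hAe
    linarith
  obtain ⟨v, hv, hvK⟩ := G.exists_move (disjoint_compl_right (a := A)) hA2
    (by rw [hcard, hKe, Finset.union_compl]) hAK
  have hc : #(A.erase v) = #A - 1 := Finset.card_erase_of_mem hv
  have hc' : (#(A.erase v) : ℝ) = #A - 1 := by rw [hc, Nat.cast_sub (by omega), Nat.cast_one]
  have hcompl : (A.erase v)ᶜ = insert v Aᶜ := Finset.compl_erase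
  have hBt : t * #(A.erase v)ᶜ < (G.edgesIn (A.erase v)ᶜ : ℝ) := by
    by_contra! hle
    have hle' := hmin (A.erase v) ⟨by omega, hle, by
      rw [hc', hcompl, Finset.card_insert_of_notMem (by simpa using hv)]
      push_cast
      linarith⟩
    omega
  refine ⟨A.erase v, (A.erase v)ᶜ, Finset.card_pos.1 (by omega), ⟨v, by simp⟩,
    disjoint_compl_right, Finset.union_compl _, ?_, hBt⟩
  have h1 : (G.edgesIn (A.erase v) : ℝ) + G.degreeIn A v = G.edgesIn A := by
    exact_mod_cast G.edgesIn_erase hv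
  have h2 : (G.degreeIn A v : ℝ) + 1 ≤ #A := by exact_mod_cast G.degreeIn_add_one_le hv
  rw [hc']
  nlinarith
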